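/- Let q be a prime power, δ ≥ 1 an integer, and F ∈ F_q[x_0, x_1, x_2] a nonzero homogeneous polynomial of degree δ. Then the number of points [v] of the projective plane ℙ(F_q^3) such that F(v) = 0 for some (equivalently, every) representative v is at most δ·q + 1. -/

import Mathlib

open MvPolynomial in
/-- A homogeneous polynomial in one variable is determined by its value at `1`. -/
theorem MvPolynomial.IsHomogeneous.eval_one_ne_zero {K : Type*} [Field K] {d : ℕ}
    {e : MvPolynomial (Fin 1) K} (he : e.IsHomogeneous d) (h0 : e ≠ 0) :
    eval (fun _ => (1 : K)) e ≠ 0 := by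
  obtain ⟨s, hs⟩ := ne_zero_iff.1 h0
  have key : ∀ t : Fin 1 →₀ ℕ, coeff t e ≠ 0 → t 0 = d := by
    intro t ht
    have := he ht
    simpa [Finsupp.weight_apply, Finsupp.sum_fintype] using this
  rw [eval_eq, Finset.sum_eq_single s]
  · simpa using hs
  · intro t ht hts
    refine absurd ?_ hts
    ext
    exact (key t (mem_support_iff.1 ht)).trans (key s hs).symm
  · intro h
    simp [notMem_support_iff.1 h]

open MvPolynomial in
theorem MvPolynomial.IsHomogeneous.natDegree_finSuccEquiv_le {K : Type*} [Field K] {n d : ℕ}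
    {F : MvPolynomial (Fin (n + 1)) K} (hF : F.IsHomogeneous d) :
    (finSuccEquiv K n F).natDegree ≤ d := by
  rw [natDegree_finSuccEquiv]
  exact (degreeOf_le_totalDegree F 0).trans hF.totalDegree_le

open MvPolynomial in
/-- If a form of degree `d` vanishes at `(1, 0, …, 0)`, the `d`-th power of the first variable
does not occur in it. -/
theorem MvPolynomial.IsHomogeneous.coeff_finSuccEquiv_eq_zero {K : Type*} [Field K] {n d : ℕ}
    {F : MvPolynomial (Fin (n + 1)) K} (hF : F.IsHomogeneous d)
    (h : eval (Fin.cons 1 0 : Fin (n + 1) → K) F = 0) :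
    (finSuccEquiv K n F).coeff d = 0 := by
  have hd : (finSuccEquiv K n F).natDegree < d + 1 :=
    Nat.lt_succ_of_le hF.natDegree_finSuccEquiv_le
  have hc : (finSuccEquiv K n F).coeff d = C (constantCoeff ((finSuccEquiv K n F).coeff d)) := by
    have := hF.finSuccEquiv_coeff_isHomogeneous d 0 (add_zero d)
    exact totalDegree_eq_zero_iff_eq_C.1 (Nat.le_zero.1 this.totalDegree_le)
  rw [eval_eq_eval_mv_eval', Polynomial.eval_map, Polynomial.eval₂_eq_sum_range' _ hd,
    Finset.sum_range_succ, Finset.sum_eq_zero] at h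
  · rw [hc, map_eq_zero_iff _ (C_injective _ _)]
    simpa [eval_zero'] using h
  · intro i hi
    rw [Finset.mem_range] at hi
    have := (hF.finSuccEquiv_coeff_isHomogeneous i (d - i) (by omega)).coeff_eq_zero (d := 0)
      (by simp; omega)
    simpa [constantCoeff_eq] using this

/-- Representatives of the points of the projective line over `K`. -/
def lineVector {K : Type*} [Field K] : Option K → Fin 2 → K
  | none => Fin.cons 1 0
  | some m => Fin.cons m fun _ => 1

theorem exists_smul_lineVector {K : Type*} [Field K] (w : Fin 2 → K) (hw : w ≠ 0) :
    ∃ (t : Option K) (a : K), a ≠ 0 ∧ w = a • lineVector t := by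
  by_cases h : w 1 = 0
  · refine ⟨none, w 0, fun h0 => hw ?_, ?_⟩
    · ext i; fin_cases i <;> assumption
    · ext i; fin_cases i
      · simp [lineVector]
      · change w 1 = w 0 * 0
        simpa using h
  · refine ⟨some (w 0 / w 1), w 1, h, ?_⟩
    ext i; fin_cases i
    · change w 0 = w 1 * (w 0 / w 1)
      field_simp
    · change w 1 = w 1 * 1
      simp

theorem Polynomial.card_filter_eval_eq_zero_le {K : Type*} [Field K] [Fintype K] [DecidableEq K]
    {p : Polynomial K} (hp : p ≠ 0) :
    (Finset.univ.filter fun m => p.eval m = 0).card ≤ p.natDegree := by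
  refine le_trans (Finset.card_le_card (t := p.roots.toFinset) ?_)
    ((Multiset.toFinset_card_le _).trans p.card_roots')
  intro m hm
  simpa [hp] using hm

theorem Finset.card_filter_option {α : Type*} [Fintype α] (P : Option α → Prop)
    [DecidablePred P] :
    (Finset.univ.filter P).card =
      (if P none then 1 else 0) + (Finset.univ.filter fun m => P (some m)).card := by
  simp only [Finset.card_filter, Fintype.sum_option]

open MvPolynomial in
/-- A nonzero binary form of degree `d` has at most `d` zeros on the projective line. -/
theorem MvPolynomial.IsHomogeneous.card_lineVector_le {K : Type*} [Field K] [Fintype K]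
    [DecidableEq K] {d : ℕ} {c : MvPolynomial (Fin 2) K} (hc : c.IsHomogeneous d) (h0 : c ≠ 0) :
    (Finset.univ.filter fun t => eval (lineVector t) c = 0).card ≤ d := by
  set P := finSuccEquiv K 1 c with hP
  set p := P.map (eval fun _ => (1 : K)) with hp
  have hPd : P.natDegree ≤ d := hc.natDegree_finSuccEquiv_le
  have hp0 : p ≠ 0 := by
    have hP0 : P ≠ 0 := by simpa [hP] using h0
    intro h
    have h1 : p.coeff P.natDegree = 0 := by simp [h]
    rw [hp, Polynomial.coeff_map] at h1
    exact (hc.finSuccEquiv_coeff_isHomogeneous P.natDegree (d - P.natDegree)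
      (by omega)).eval_one_ne_zero (Polynomial.leadingCoeff_ne_zero.2 hP0) h1
  have hpd : p.natDegree ≤ d := Polynomial.natDegree_map_le.trans hPd
  have hroots := Polynomial.card_filter_eval_eq_zero_le hp0
  rw [Finset.card_filter_option]
  have hs : ∀ m, eval (lineVector (some m)) c = p.eval m := fun m =>
    eval_eq_eval_mv_eval' _ _ _
  simp only [hs]
  split_ifs with hn
  · have hz : p.coeff d = 0 := by
      rw [hp, Polynomial.coeff_map, hP, hc.coeff_finSuccEquiv_eq_zero hn, map_zero]
    have : p.natDegree ≠ d := fun h => hp0 (by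
      rw [← Polynomial.leadingCoeff_eq_zero, Polynomial.leadingCoeff, h, hz])
    omega
  · omega

/-- The arithmetic behind the pencil count: `a` of the `q + 1` lines are contained in the curve. -/
theorem pencil_count_le {q δ a e : ℕ} (hδ : 1 ≤ δ) (haδ : a ≤ δ) (haq : a ≤ q + 1)
    (he : e ≤ q) (hea : e ≤ δ - a) (he1 : e ≤ δ - 1) :
    a * q + (q + 1 - a) * e ≤ δ * q := by
  obtain ⟨b, rfl⟩ := Nat.exists_eq_add_of_le haδ
  obtain ⟨r, hr⟩ := Nat.exists_eq_add_of_le haq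
  have h1 : q + 1 - a = r := by omega
  rw [h1]
  rcases Nat.eq_zero_or_pos a with rfl | ha
  · have : r = q + 1 := by omega
    subst this
    obtain ⟨k, rfl⟩ : ∃ k, b = k + 1 := ⟨b - 1, by omega⟩
    have : e ≤ k := by omega
    nlinarith
  · have h2 : e ≤ b := by omega
    have h3 : r ≤ q := by omega
    nlinarith [Nat.mul_le_mul h3 h2]

open MvPolynomial in
theorem MvPolynomial.IsHomogeneous.card_pencil_le {K : Type*} [Field K] [Fintype K]
    [DecidableEq K] {δ : ℕ} (hδ : 1 ≤ δ) {F : MvPolynomial (Fin 3) K} (hF : F.IsHomogeneous δ)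
    (h0 : F ≠ 0) (hP : eval (Fin.cons 1 0 : Fin 3 → K) F = 0) :
    (Finset.univ.filter fun z : Option K × K =>
      eval (Fin.cons z.2 (lineVector z.1) : Fin 3 → K) F = 0).card ≤ δ * Fintype.card K := by
  set q := Fintype.card K with hq
  set G := finSuccEquiv K 2 F with hG
  have hG0 : G ≠ 0 := by simpa [hG] using h0
  let A : Finset (Option K) :=
    Finset.univ.filter fun t => G.map (eval (lineVector t)) = 0
  have hGd : G.natDegree ≤ δ := hF.natDegree_finSuccEquiv_le
  have hcoeff : ∀ k, G.coeff k ≠ 0 → k + A.card ≤ δ := by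
    intro k hk
    have hkd : k ≤ δ := (Polynomial.le_natDegree_of_ne_zero hk).trans hGd
    have h1 := (hF.finSuccEquiv_coeff_isHomogeneous k (δ - k)
      (by omega)).card_lineVector_le hk
    have h2 : A.card ≤ δ - k := by
      refine le_trans (Finset.card_le_card ?_) h1
      intro t ht
      simp only [A, Finset.mem_filter, Finset.mem_univ, true_and] at ht ⊢
      have := congrArg (fun p => Polynomial.coeff p k) ht
      simpa [Polynomial.coeff_map] using this
    omega
  have hlead : G.coeff G.natDegree ≠ 0 := Polynomial.leadingCoeff_ne_zero.2 hG0
  have hA : G.natDegree + A.card ≤ δ := hcoeff _ hlead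
  have hne : G.natDegree ≠ δ := fun h => hlead (by
    rw [h]; exact hF.coeff_finSuccEquiv_eq_zero hP)
  have hAq : A.card ≤ q + 1 := by
    simpa [hq] using Finset.card_le_univ A
  have hsum : (Finset.univ.filter fun z : Option K × K =>
      eval (Fin.cons z.2 (lineVector z.1) : Fin 3 → K) F = 0).card =
      ∑ t : Option K, (Finset.univ.filter fun x : K =>
        (G.map (eval (lineVector t))).eval x = 0).card := by
    simp only [Finset.card_filter, Fintype.sum_prod_type, eval_eq_eval_mv_eval', hG]
  have hbound : ∀ t : Option K, (Finset.univ.filter fun x : K =>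
      (G.map (eval (lineVector t))).eval x = 0).card ≤
      if t ∈ A then q else min q G.natDegree := by
    intro t
    split_ifs with ht
    · exact Finset.card_le_univ _
    · refine le_min (Finset.card_le_univ _) ?_
      refine (Polynomial.card_filter_eval_eq_zero_le ?_).trans Polynomial.natDegree_map_le
      simpa [A] using ht
  rw [hsum]
  refine (Finset.sum_le_sum fun t _ => hbound t).trans ?_
  rw [Finset.sum_ite, Finset.sum_const, Finset.sum_const, smul_eq_mul, smul_eq_mul]
  have hA1 : (Finset.univ.filter fun t => t ∈ A) = A := by ext; simp
  have hA2 : (Finset.univ.filter fun t => t ∉ A).card = q + 1 - A.card := by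
    have : (Finset.univ.filter fun t => t ∉ A) = Aᶜ := by ext; simp
    rw [this, Finset.card_compl, Fintype.card_option]
  rw [hA1, hA2]
  exact pencil_count_le hδ (by omega) hAq (min_le_left _ _)
    ((min_le_right _ _).trans (by omega)) ((min_le_right _ _).trans (by omega))

/-- The general linear group acts transitively on nonzero vectors. -/
theorem LinearEquiv.exists_apply_eq_of_ne_zero {K V : Type*} [Field K] [AddCommGroup V]
    [Module K V] {v w : V} (hv : v ≠ 0) (hw : w ≠ 0) : ∃ g : V ≃ₗ[K] V, g v = w := by
  let f := (LinearEquiv.toSpanNonzeroSingleton K V v hv).symm ≪≫ₗ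
    LinearEquiv.toSpanNonzeroSingleton K V w hw
  obtain ⟨g, hg⟩ := Submodule.exists_linearEquiv_restrict_eq f
  refine ⟨g, ?_⟩
  have h1 := hg (LinearEquiv.toSpanNonzeroSingleton K V v hv 1)
  rw [LinearEquiv.trans_apply, LinearEquiv.symm_apply_apply] at h1
  simpa using h1.symm

open MvPolynomial in
theorem MvPolynomial.IsHomogeneous.exists_comp_linearEquiv {K : Type*} [Field K] {n δ : ℕ}
    {F : MvPolynomial (Fin n) K} (hF : F.IsHomogeneous δ) (h0 : F ≠ 0)
    (g : (Fin n → K) ≃ₗ[K] (Fin n → K)) :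
    ∃ F' : MvPolynomial (Fin n) K, F' ≠ 0 ∧ F'.IsHomogeneous δ ∧
      ∀ v, eval v F' = eval (g v) F := by
  let M := LinearMap.toMatrix' g.toLinearMap
  let N := LinearMap.toMatrix' g.symm.toLinearMap
  have hMN : M * N = 1 := by
    rw [← LinearMap.toMatrix'_comp]
    simp
  refine ⟨bind₁ M.toMvPolynomial F, ?_, ?_, ?_⟩
  · intro h
    apply h0
    have h1 : bind₁ N.toMvPolynomial (bind₁ M.toMvPolynomial F) = F := by
      rw [bind₁_bind₁]
      simp only [← Matrix.toMvPolynomial_mul, hMN, Matrix.toMvPolynomial_one]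
      exact aeval_X_left_apply F
    rw [← h1, h, map_zero]
  · simpa using hF.aeval M.toMvPolynomial M.toMvPolynomial_isHomogeneous
  · intro v
    have hv : (fun i => eval v (M.toMvPolynomial i)) = g v := by
      ext i
      rw [Matrix.toMvPolynomial_eval_eq_apply]
      change (LinearMap.toMatrix' g.toLinearMap).mulVec v i = _
      rw [LinearMap.toMatrix'_mulVec]
      rfl
    rw [← hv]
    exact eval₂Hom_bind₁ (RingHom.id K) v M.toMvPolynomial F

open MvPolynomial in
theorem MvPolynomial.IsHomogeneous.eval_smul_eq {K σ : Type*} [Field K] {δ : ℕ}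
    {F : MvPolynomial σ K} (hF : F.IsHomogeneous δ) (a : K) (v : σ → K) :
    eval (a • v) F = a ^ δ * eval v F := by
  rw [eval_eq, eval_eq, Finset.mul_sum]
  refine Finset.sum_congr rfl fun d hd => ?_
  have h : ∑ i ∈ d.support, d i = δ := by
    simpa [Finsupp.weight_apply, Finsupp.sum] using hF (mem_support_iff.1 hd)
  simp only [Pi.smul_apply, smul_eq_mul, mul_pow, Finset.prod_mul_distrib,
    Finset.prod_pow_eq_pow_sum, h]
  ring

/-- A plane projective curve of degree `δ` over `𝔽_q` has at most `δ·q + 1`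
rational points (base case `n = 2` of the paper's induction, after Serre). -/
theorem plane_curve_bound
    (K : Type*) [Field K] [Fintype K] (q δ : ℕ)
    (hq : Fintype.card K = q) (hδ : 1 ≤ δ)
    (F : MvPolynomial (Fin 3) K) (hF : F ≠ 0)
    (hhom : F.IsHomogeneous δ) :
    Set.ncard {x : Projectivization K (Fin 3 → K) | MvPolynomial.eval x.rep F = 0}
      ≤ δ * q + 1 := by
  classical
  subst hq
  rcases Set.eq_empty_or_nonempty
    {x : Projectivization K (Fin 3 → K) | MvPolynomial.eval x.rep F = 0} with hE | ⟨P, hPF⟩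
  · rw [hE]; simp
  have he : (Fin.cons 1 0 : Fin 3 → K) ≠ 0 := fun h => one_ne_zero (congrFun h 0)
  obtain ⟨g, hg⟩ := LinearEquiv.exists_apply_eq_of_ne_zero (K := K) he P.rep_nonzero
  obtain ⟨F', hF'0, hF', hev⟩ := hhom.exists_comp_linearEquiv hF g
  have hcard := hF'.card_pencil_le hδ hF'0 (by rw [hev, hg]; exact hPF)
  set Z := Finset.univ.filter fun z : Option K × K =>
      MvPolynomial.eval (Fin.cons z.2 (lineVector z.1) : Fin 3 → K) F' = 0 with hZ
  have hne : ∀ z : Option K × K, g (Fin.cons z.2 (lineVector z.1) : Fin 3 → K) ≠ 0 := by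
    intro z h
    rw [g.map_eq_zero_iff] at h
    rcases z with ⟨_ | m, x⟩
    · exact one_ne_zero (congrFun h 1)
    · exact one_ne_zero (congrFun h 2)
  let φ : Option K × K → Projectivization K (Fin 3 → K) := fun z =>
    Projectivization.mk K _ (hne z)
  have hsub : {x : Projectivization K (Fin 3 → K) | MvPolynomial.eval x.rep F = 0} ⊆
      (insert P (Z.image φ) : Finset _) := by
    intro x hx
    obtain ⟨v, hv⟩ := g.surjective x.rep
    have hxv : Projectivization.mk K (g v) (hv ▸ x.rep_nonzero) = x := by
      simp only [hv, Projectivization.mk_rep]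
    have hFv : MvPolynomial.eval v F' = 0 := by rw [hev, hv]; exact hx
    have hcons : v = (Fin.cons (v 0) (Fin.tail v) : Fin 3 → K) :=
      (Fin.cons_self_tail v).symm
    rw [Finset.coe_insert, Finset.coe_image]
    by_cases hw : Fin.tail v = 0
    · left
      have hv' : v = v 0 • (Fin.cons 1 0 : Fin 3 → K) := by
        ext i
        refine Fin.cases (by simp) (fun j => ?_) i
        simpa [Fin.tail] using congrFun hw j
      rw [← hxv, ← P.mk_rep, Projectivization.mk_eq_mk_iff']
      exact ⟨v 0, by rw [← hg, ← map_smul, ← hv']⟩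
    · right
      obtain ⟨t, a, ha, hta⟩ := exists_smul_lineVector _ hw
      have hv' : v = a • (Fin.cons (a⁻¹ * v 0) (lineVector t) : Fin 3 → K) := by
        ext i
        refine Fin.cases (by simp [ha]) (fun j => ?_) i
        simpa [Fin.tail] using congrFun hta j
      refine ⟨(t, a⁻¹ * v 0), ?_, ?_⟩
      · rw [hv', hF'.eval_smul_eq] at hFv
        simpa [hZ, ha] using hFv
      · rw [← hxv, Projectivization.mk_eq_mk_iff']
        exact ⟨a⁻¹, by rw [← map_smul]; congr 1; rw [hv']; simp [smul_smul, ha]⟩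
  calc _ ≤ (insert P (Z.image φ) : Finset _).card := by
        rw [← Set.ncard_coe_finset]
        exact Set.ncard_le_ncard hsub (Finset.finite_toSet _)
    _ ≤ (Z.image φ).card + 1 := Finset.card_insert_le _ _
    _ ≤ _ := Nat.add_le_add_right (Finset.card_image_le.trans hcard) 1
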